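/- arXiv:1402.2755 — 2 statements merged into one kernel-verified Lean document; each statement's English description precedes it below -/
import Mathlib

section
/- Let 𝕏 be a nonempty standard Borel space, f : 𝕏 → ℝ a bounded measurable function, s > 0 a real number, n ≥ 1, and X_1,…,X_n ∈ 𝕏. Then the infimum, over all Borel probability measures μ on 𝕏, of ∫ f d((s/(s+n))·μ + (1/(s+n))·∑_{i=1}^n δ_{X_i}) equals (s/(s+n))·⨅_x f(x) + (n/(s+n))·S_n(f), and the corresponding supremum equals (s/(s+n))·⨆_x f(x) + (n/(s+n))·S_n(f), where S_n(f) = (1/n)∑_{i=1}^n f(X_i). -/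
open MeasureTheory

/-- The integral of a bounded measurable function under a nonnegative combination of a
finite measure and finitely many Dirac measures. -/
theorem integral_smul_add_smul_sum_dirac {α ι : Type*} [MeasurableSpace α] [Fintype ι]
    {f : α → ℝ} (hf : Measurable f) {C : ℝ} (hC : ∀ x, |f x| ≤ C) {a b : ℝ} (ha : 0 ≤ a)
    (hb : 0 ≤ b) (X : ι → α) (μ : Measure α) [IsFiniteMeasure μ] :
    ∫ x, f x ∂(ENNReal.ofReal a • μ + ENNReal.ofReal b • ∑ i, Measure.dirac (X i))
      = a * ∫ x, f x ∂μ + b * ∑ i, f (X i) := by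
  have hfi : ∀ ν : Measure α, IsFiniteMeasure ν → Integrable f ν := fun ν _ =>
    Integrable.of_bound hf.aestronglyMeasurable C (ae_of_all _ hC)
  rw [integral_add_measure ((hfi μ inferInstance).smul_measure ENNReal.ofReal_ne_top)
      ((hfi _ inferInstance).smul_measure ENNReal.ofReal_ne_top),
    integral_smul_measure, integral_smul_measure,
    integral_finsetSum_measure fun i _ => hfi _ inferInstance]
  simp [integral_dirac' _ _ hf.stronglyMeasurable, ENNReal.toReal_ofReal, ha, hb]

/-- The supremum of the expectations of a bounded measurable function over all probability
measures is the supremum of the function. -/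
theorem isLUB_range_integral_probabilityMeasure {α : Type*} [MeasurableSpace α] [Nonempty α]
    {f : α → ℝ} (hf : Measurable f) {C : ℝ} (hC : ∀ x, |f x| ≤ C) :
    IsLUB (Set.range fun μ : {μ : Measure α // IsProbabilityMeasure μ} => ∫ x, f x ∂μ.1)
      (⨆ x, f x) := by
  have hbdd : BddAbove (Set.range f) :=
    ⟨C, Set.forall_mem_range.2 fun x => (abs_le.1 (hC x)).2⟩
  refine ⟨Set.forall_mem_range.2 fun ⟨μ, hμ⟩ => ?_, fun c hc => ciSup_le fun x => ?_⟩
  · have hfi : Integrable f μ :=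
      Integrable.of_bound hf.aestronglyMeasurable C (ae_of_all _ hC)
    simpa using integral_mono hfi (integrable_const (⨆ x, f x)) fun x => le_ciSup hbdd x
  · rw [← integral_dirac' f x hf.stronglyMeasurable]
    exact hc ⟨⟨Measure.dirac x, inferInstance⟩, rfl⟩

/-- The infimum of the expectations of a bounded measurable function over all probability
measures is the infimum of the function. -/
theorem isGLB_range_integral_probabilityMeasure {α : Type*} [MeasurableSpace α] [Nonempty α]
    {f : α → ℝ} (hf : Measurable f) {C : ℝ} (hC : ∀ x, |f x| ≤ C) :
    IsGLB (Set.range fun μ : {μ : Measure α // IsProbabilityMeasure μ} => ∫ x, f x ∂μ.1)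
      (⨅ x, f x) := by
  have hbdd : BddBelow (Set.range f) :=
    ⟨-C, Set.forall_mem_range.2 fun x => (abs_le.1 (hC x)).1⟩
  refine ⟨Set.forall_mem_range.2 fun ⟨μ, hμ⟩ => ?_, fun c hc => le_ciInf fun x => ?_⟩
  · have hfi : Integrable f μ :=
      Integrable.of_bound hf.aestronglyMeasurable C (ae_of_all _ hC)
    simpa using integral_mono (integrable_const (⨅ x, f x)) hfi fun x => ciInf_le hbdd x
  · rw [← integral_dirac' f x hf.stronglyMeasurable]
    exact hc ⟨⟨Measure.dirac x, inferInstance⟩, rfl⟩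

/-- posterior inference under the imprecise Dirichlet process.
The infimum (resp. supremum) over all Borel probability measures `μ` of
`∫ f d((s/(s+n))·μ + (1/(s+n))·∑ δ_{X i})` equals
`(s/(s+n))·⨅ f + (n/(s+n))·S_n(f)` (resp. with `⨆ f`). -/
theorem idp_posterior_inference
    {𝕏 : Type*} [MeasurableSpace 𝕏] [StandardBorelSpace 𝕏] [Nonempty 𝕏]
    (f : 𝕏 → ℝ) (hf : Measurable f) (C : ℝ) (hC : ∀ x, |f x| ≤ C)
    (s : ℝ) (hs : 0 < s) (n : ℕ) (hn : 1 ≤ n) (X : Fin n → 𝕏) :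
    (⨅ μ : {μ : Measure 𝕏 // IsProbabilityMeasure μ},
        ∫ x, f x ∂(ENNReal.ofReal (s / (s + n)) • (μ : Measure 𝕏)
          + ENNReal.ofReal (1 / (s + n)) • ∑ i, Measure.dirac (X i)))
      = (s / (s + n)) * (⨅ x, f x) + (n / (s + n)) * ((1 / n) * ∑ i, f (X i)) ∧
    (⨆ μ : {μ : Measure 𝕏 // IsProbabilityMeasure μ},
        ∫ x, f x ∂(ENNReal.ofReal (s / (s + n)) • (μ : Measure 𝕏)
          + ENNReal.ofReal (1 / (s + n)) • ∑ i, Measure.dirac (X i)))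
      = (s / (s + n)) * (⨆ x, f x) + (n / (s + n)) * ((1 / n) * ∑ i, f (X i)) := by
  have hn0 : (n : ℝ) ≠ 0 := by positivity
  have : Nonempty {μ : Measure 𝕏 // IsProbabilityMeasure μ} :=
    ⟨⟨Measure.dirac (Classical.arbitrary 𝕏), inferInstance⟩⟩
  have hglb := isGLB_range_integral_probabilityMeasure hf hC
  have hlub := isLUB_range_integral_probabilityMeasure hf hC
  have hsum : (n / (s + n)) * ((1 / n) * ∑ i, f (X i)) = 1 / (s + n) * ∑ i, f (X i) := by
    field_simp
  have hs0 : 0 ≤ s / (s + n) := by positivity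
  have key : ∀ μ : {μ : Measure 𝕏 // IsProbabilityMeasure μ},
      ∫ x, f x ∂(ENNReal.ofReal (s / (s + n)) • (μ : Measure 𝕏)
          + ENNReal.ofReal (1 / (s + n)) • ∑ i, Measure.dirac (X i))
        = s / (s + n) * ∫ x, f x ∂μ.1 + 1 / (s + n) * ∑ i, f (X i) := fun ⟨μ, _⟩ =>
    integral_smul_add_smul_sum_dirac hf hC hs0 (by positivity) X μ
  simp_rw [key, hsum]
  constructor
  · rw [← hglb.ciInf_eq, Real.mul_iInf_of_nonneg hs0, ciInf_add]
    exact hglb.bddBelow.range_comp_left (monotone_mul_left_of_nonneg hs0)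
  · rw [← hlub.ciSup_eq, Real.mul_iSup_of_nonneg hs0, ciSup_add]
    exact hlub.bddAbove.range_comp_left (monotone_mul_left_of_nonneg hs0)
end

section
/- Let s > 0 and let X_1,…,X_{n₁} and Y_1,…,Y_{n₂} be real numbers. For Borel probability measures ν₁, ν₂ on ℝ with cumulative distribution functions G₁, G₂, define M(ν₁, ν₂) = ∫ G_{n₁}(y) dμ_{n₂}(y), where G_{n₁}(y) = (s/(s+n₁))·G₁(y) + (1/(s+n₁))·∑_{j=1}^{n₁} 1{X_j ≤ y} and μ_{n₂} = (s/(s+n₂))·ν₂ + (1/(s+n₂))·∑_{k=1}^{n₂} δ_{Y_k}. Then the infimum of M(ν₁, ν₂) over all pairs (ν₁, ν₂) of Borel probability measures on ℝ equals U/((s+n₁)(s+n₂)), and the supremum equals U/((s+n₁)(s+n₂)) + s(s+n₁+n₂)/((s+n₁)(s+n₂)), where U = ∑_{i=1}^{n₁} ∑_{j=1}^{n₂} 1{X_i ≤ Y_j}; moreover both bounds are attained by Dirac measures ν₁ = δ_{x₀}, ν₂ = δ_{y₀} (with x₀ > max_k Y_k, y₀ < min_j X_j for the infimum, and x₀ <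 min_k Y_k, y₀ > max_j X_j for the supremum). -/
open MeasureTheory

/-- The mixture `(s / (s + m)) G + (1 / (s + m)) ∑ⱼ 1{Xⱼ ≤ y}` of the cumulative distribution
function of `ν` and the empirical one. -/
noncomputable def posteriorCdf {m : ℕ} (s : ℝ) (X : Fin m → ℝ) (ν : Measure ℝ) (y : ℝ) : ℝ :=
  (s / (s + m)) * (ν (Set.Iic y)).toReal
    + (1 / (s + m)) * ∑ j, (if X j ≤ y then (1 : ℝ) else 0)

theorem posteriorCdf_eq {m : ℕ} (s : ℝ) (X : Fin m → ℝ) (ν : Measure ℝ) (y : ℝ) :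
    posteriorCdf s X ν y
      = (s * (ν (Set.Iic y)).toReal + ∑ j, (if X j ≤ y then (1 : ℝ) else 0)) / (s + m) := by
  unfold posteriorCdf
  ring

theorem sum_ite_le_card {m : ℕ} (X : Fin m → ℝ) (y : ℝ) :
    ∑ j, (if X j ≤ y then (1 : ℝ) else 0) ≤ m := by
  calc ∑ j, (if X j ≤ y then (1 : ℝ) else 0) ≤ ∑ _j : Fin m, (1 : ℝ) :=
        Finset.sum_le_sum fun j _ => by split_ifs <;> norm_num
    _ = m := by simp

theorem sum_ite_nonneg {m : ℕ} (X : Fin m → ℝ) (y : ℝ) :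
    0 ≤ ∑ j, (if X j ≤ y then (1 : ℝ) else 0) :=
  Finset.sum_nonneg fun j _ => by split_ifs <;> norm_num

theorem toReal_prob_le_one (ν : Measure ℝ) [IsProbabilityMeasure ν] (A : Set ℝ) :
    (ν A).toReal ≤ 1 :=
  measureReal_le_one

theorem posteriorCdf_nonneg {m : ℕ} {s : ℝ} (hs : 0 < s) (X : Fin m → ℝ) (ν : Measure ℝ) (y : ℝ) :
    0 ≤ posteriorCdf s X ν y := by
  have := sum_ite_nonneg X y
  unfold posteriorCdf
  positivity

theorem posteriorCdf_le_one {m : ℕ} {s : ℝ} (hs : 0 < s) (X : Fin m → ℝ) (ν : Measure ℝ)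
    [IsProbabilityMeasure ν] (y : ℝ) : posteriorCdf s X ν y ≤ 1 := by
  have h := sum_ite_le_card X y
  have h' := toReal_prob_le_one ν (Set.Iic y)
  rw [posteriorCdf_eq, div_le_one (by positivity)]
  nlinarith

theorem measurable_posteriorCdf {m : ℕ} (s : ℝ) (X : Fin m → ℝ) (ν : Measure ℝ)
    [IsProbabilityMeasure ν] : Measurable (posteriorCdf s X ν) := by
  have hmono : Monotone fun y => (ν (Set.Iic y)).toReal := fun a b hab =>
    ENNReal.toReal_mono (measure_ne_top _ _) (measure_mono (Set.Iic_subset_Iic.2 hab))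
  refine (hmono.measurable.const_mul _).add (Measurable.const_mul ?_ _)
  exact Finset.measurable_sum _ fun j _ =>
    Measurable.ite measurableSet_Ici measurable_const measurable_const

theorem integral_posterior_mixture {n : ℕ} {s : ℝ} (hs : 0 < s) (Y : Fin n → ℝ) (ν : Measure ℝ)
    [IsProbabilityMeasure ν] {g : ℝ → ℝ} (hg : Measurable g) (h0 : ∀ y, 0 ≤ g y)
    (h1 : ∀ y, g y ≤ 1) :
    ∫ y, g y ∂(ENNReal.ofReal (s / (s + n)) • ν
        + ENNReal.ofReal (1 / (s + n)) • ∑ k, Measure.dirac (Y k))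
      = (s * ∫ y, g y ∂ν + ∑ k, g (Y k)) / (s + n) := by
  have hint : ∀ μ : Measure ℝ, IsFiniteMeasure μ → Integrable g μ := fun μ _ =>
    Integrable.of_bound hg.aestronglyMeasurable 1
      (Filter.Eventually.of_forall fun y => by rw [Real.norm_of_nonneg (h0 y)]; exact h1 y)
  have hsum : Integrable g (∑ k, Measure.dirac (Y k)) :=
    integrable_finsetSum_measure.2 fun k _ => hint _ inferInstance
  rw [integral_add_measure ((hint ν inferInstance).smul_measure ENNReal.ofReal_ne_top)
      (hsum.smul_measure ENNReal.ofReal_ne_top), integral_smul_measure, integral_smul_measure,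
    integral_finsetSum_measure fun k _ => hint _ inferInstance,
    ENNReal.toReal_ofReal (by positivity), ENNReal.toReal_ofReal (by positivity)]
  simp only [integral_dirac, smul_eq_mul]
  ring

/-- the paper's equation (13): lower and upper posterior means of
`P(X ≤ Y)` under the imprecise Dirichlet process, with attainment by Dirac base
measures. -/
theorem idp_lower_upper_posterior_mean_PXleY
    (s : ℝ) (hs : 0 < s) (n₁ n₂ : ℕ) (hn₁ : 1 ≤ n₁) (hn₂ : 1 ≤ n₂)
    (X : Fin n₁ → ℝ) (Y : Fin n₂ → ℝ)
    (M : Measure ℝ → Measure ℝ → ℝ)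
    (hM : ∀ ν₁ ν₂ : Measure ℝ, M ν₁ ν₂ =
      ∫ y, ((s / (s + n₁)) * (ν₁ (Set.Iic y)).toReal
            + (1 / (s + n₁)) * ∑ j, (if X j ≤ y then (1 : ℝ) else 0))
        ∂(ENNReal.ofReal (s / (s + n₂)) • ν₂
          + ENNReal.ofReal (1 / (s + n₂)) • ∑ k, Measure.dirac (Y k))) :
    (⨅ p : {ν : Measure ℝ // IsProbabilityMeasure ν} ×
           {ν : Measure ℝ // IsProbabilityMeasure ν}, M p.1 p.2)
      = (∑ i, ∑ j, (if X i ≤ Y j then (1 : ℝ) else 0)) / ((s + n₁) * (s + n₂)) ∧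
    (⨆ p : {ν : Measure ℝ // IsProbabilityMeasure ν} ×
           {ν : Measure ℝ // IsProbabilityMeasure ν}, M p.1 p.2)
      = (∑ i, ∑ j, (if X i ≤ Y j then (1 : ℝ) else 0)) / ((s + n₁) * (s + n₂))
        + s * (s + n₁ + n₂) / ((s + n₁) * (s + n₂)) ∧
    (∀ x₀ y₀ : ℝ, y₀ < x₀ → (∀ k, Y k < x₀) → (∀ j, y₀ < X j) →
      M (Measure.dirac x₀) (Measure.dirac y₀)
        = (∑ i, ∑ j, (if X i ≤ Y j then (1 : ℝ) else 0)) / ((s + n₁) * (s + n₂))) ∧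
    (∀ x₀ y₀ : ℝ, x₀ < y₀ → (∀ k, x₀ < Y k) → (∀ j, X j < y₀) →
      M (Measure.dirac x₀) (Measure.dirac y₀)
        = (∑ i, ∑ j, (if X i ≤ Y j then (1 : ℝ) else 0)) / ((s + n₁) * (s + n₂))
          + s * (s + n₁ + n₂) / ((s + n₁) * (s + n₂))) := by
  set U : ℝ := ∑ i, ∑ j, (if X i ≤ Y j then (1 : ℝ) else 0)
  have hU' : ∑ k, ∑ j, (if X j ≤ Y k then (1 : ℝ) else 0) = U := Finset.sum_comm
  have hs₁ : 0 < s + n₁ := by positivity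
  have hs₂ : 0 < s + n₂ := by positivity
  have hM' : ∀ ν₁ ν₂ : Measure ℝ, IsProbabilityMeasure ν₁ → IsProbabilityMeasure ν₂ →
      M ν₁ ν₂ = (s * ∫ y, posteriorCdf s X ν₁ y ∂ν₂ + ∑ k, posteriorCdf s X ν₁ (Y k))
        / (s + n₂) := fun ν₁ ν₂ _ _ => (hM ν₁ ν₂).trans
    (integral_posterior_mixture hs Y ν₂ (measurable_posteriorCdf s X ν₁)
      (posteriorCdf_nonneg hs X ν₁) (posteriorCdf_le_one hs X ν₁))
  have hsum : ∀ ν : Measure ℝ, ∑ k, posteriorCdf s X ν (Y k)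
      = (s * ∑ k, (ν (Set.Iic (Y k))).toReal + U) / (s + n₁) := fun ν => by
    simp only [posteriorCdf_eq]
    rw [← Finset.sum_div, Finset.sum_add_distrib, ← Finset.mul_sum, hU']
  have hlower : ∀ ν₁ ν₂ : Measure ℝ, IsProbabilityMeasure ν₁ → IsProbabilityMeasure ν₂ →
      U / ((s + n₁) * (s + n₂)) ≤ M ν₁ ν₂ := fun ν₁ ν₂ h₁ h₂ => by
    have hi : 0 ≤ ∫ y, posteriorCdf s X ν₁ y ∂ν₂ := integral_nonneg (posteriorCdf_nonneg hs X ν₁)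
    have hk : 0 ≤ ∑ k, (ν₁ (Set.Iic (Y k))).toReal :=
      Finset.sum_nonneg fun k _ => ENNReal.toReal_nonneg
    rw [hM' ν₁ ν₂ h₁ h₂, hsum, ← div_div]
    gcongr
    have : U / (s + n₁) ≤ (s * ∑ k, (ν₁ (Set.Iic (Y k))).toReal + U) / (s + n₁) := by
      gcongr
      nlinarith
    nlinarith
  have hval : U / ((s + n₁) * (s + n₂)) + s * (s + n₁ + n₂) / ((s + n₁) * (s + n₂))
      = (s * 1 + (s * n₂ + U) / (s + n₁)) / (s + n₂) := by
    field_simp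
    ring
  have hupper : ∀ ν₁ ν₂ : Measure ℝ, IsProbabilityMeasure ν₁ → IsProbabilityMeasure ν₂ →
      M ν₁ ν₂ ≤ U / ((s + n₁) * (s + n₂)) + s * (s + n₁ + n₂) / ((s + n₁) * (s + n₂)) :=
    fun ν₁ ν₂ h₁ h₂ => by
    have hi : ∫ y, posteriorCdf s X ν₁ y ∂ν₂ ≤ 1 := by
      have h := integral_mono_of_nonneg (μ := ν₂)
        (Filter.Eventually.of_forall (posteriorCdf_nonneg hs X ν₁)) (integrable_const (1 : ℝ))
        (Filter.Eventually.of_forall (posteriorCdf_le_one hs X ν₁))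
      simpa using h
    have hk : ∑ k, (ν₁ (Set.Iic (Y k))).toReal ≤ n₂ := by
      calc ∑ k, (ν₁ (Set.Iic (Y k))).toReal ≤ ∑ _k : Fin n₂, (1 : ℝ) :=
            Finset.sum_le_sum fun k _ => toReal_prob_le_one ν₁ _
        _ = n₂ := by simp
    rw [hM' ν₁ ν₂ h₁ h₂, hsum, hval]
    gcongr
  have hmin : ∀ x₀ y₀ : ℝ, y₀ < x₀ → (∀ k, Y k < x₀) → (∀ j, y₀ < X j) →
      M (Measure.dirac x₀) (Measure.dirac y₀) = U / ((s + n₁) * (s + n₂)) := by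
    intro x₀ y₀ h hY hX
    rw [hM' _ _ inferInstance inferInstance, hsum, integral_dirac, posteriorCdf_eq]
    simp [h, hY, fun j => not_le.2 (hX j), div_div]
  have hmax : ∀ x₀ y₀ : ℝ, x₀ < y₀ → (∀ k, x₀ < Y k) → (∀ j, X j < y₀) →
      M (Measure.dirac x₀) (Measure.dirac y₀)
        = U / ((s + n₁) * (s + n₂)) + s * (s + n₁ + n₂) / ((s + n₁) * (s + n₂)) := by
    intro x₀ y₀ h hY hX
    rw [hM' _ _ inferInstance inferInstance, hsum, integral_dirac, posteriorCdf_eq, hval]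
    simp [h.le, fun k => (hY k).le, fun j => (hX j).le, hs₁.ne']
  obtain ⟨aX, haX⟩ := (Set.finite_range X).bddBelow
  obtain ⟨bX, hbX⟩ := (Set.finite_range X).bddAbove
  obtain ⟨aY, haY⟩ := (Set.finite_range Y).bddBelow
  obtain ⟨bY, hbY⟩ := (Set.finite_range Y).bddAbove
  simp only [mem_lowerBounds, mem_upperBounds, Set.forall_mem_range] at haX hbX haY hbY
  refine ⟨IsLeast.csInf_eq ⟨?_, ?_⟩, IsGreatest.csSup_eq ⟨?_, ?_⟩, hmin, hmax⟩
  · refine ⟨(⟨Measure.dirac (max bY aX + 1), inferInstance⟩,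
      ⟨Measure.dirac (aX - 1), inferInstance⟩), hmin _ _ ?_ (fun k => ?_) fun j => ?_⟩
    · linarith [le_max_right bY aX]
    · linarith [le_max_left bY aX, hbY k]
    · linarith [haX j]
  · rintro _ ⟨p, rfl⟩
    exact hlower _ _ p.1.2 p.2.2
  · refine ⟨(⟨Measure.dirac (aY - 1), inferInstance⟩,
      ⟨Measure.dirac (max bX aY + 1), inferInstance⟩), hmax _ _ ?_ (fun k => ?_) fun j => ?_⟩
    · linarith [le_max_right bX aY]
    · linarith [haY k]
    · linarith [le_max_left bX aY, hbX j]
  · rintro _ ⟨p, rfl⟩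
    exact hupper _ _ p.1.2 p.2.2
end
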